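/- Let S ∈ 𝒮_t. Then φ_t^S(Z) := π_t^S(Z e_1) admits the primal representation φ_t^S(Z) = essinf{ m ∈ L^∞(F_t) : Z + m ∈ S_T^T A_t^π } for every Z ∈ L^∞(F), where A_t^π := { X ∈ L^∞_d(F) : π_t^S(X) ≤ 0 }, and the dual representation φ_t^S(Z) = esssup_{Q ∈ Q^e(S)} ( −β_t(Q,S) − E^Q[Z|F_t] ) for every Z ∈ L^∞(F). -/

import Mathlib

open MeasureTheory Filter Set
open scoped ENNReal

noncomputable section

namespace RiskPaper

variable {Ω : Type*}

/-- Euclidean inner product on `Fin d → ℝ`. -/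
def dot {d : ℕ} (x y : Fin d → ℝ) : ℝ := ∑ i, x i * y i

/-- The first unit vector `e₁ = (1,0,…,0) ∈ ℝ^d`. -/
def e1 (d : ℕ) : Fin d → ℝ := fun i => if (i : ℕ) = 0 then 1 else 0

/-- The `i`-th unit vector of `ℝ^d`. -/
def eVec {d : ℕ} (i : Fin d) : Fin d → ℝ := fun j => if j = i then 1 else 0

/-- Measurability with respect to an explicitly given σ-algebra on the domain. -/
def MeasF {α : Type*} [MeasurableSpace α] (m : MeasurableSpace Ω) (f : Ω → α) : Prop :=
  @Measurable Ω α m _ f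

/-- `L^∞_d(F_t)`: bounded `F_t`-measurable `ℝ^d`-valued random variables
(pointwise representatives). -/
def LinfD (F : ℕ → MeasurableSpace Ω) (d t : ℕ) : Set (Ω → Fin d → ℝ) :=
  {X | MeasF (F t) X ∧ ∃ C : ℝ, ∀ ω i, |X ω i| ≤ C}

/-- `L^∞(F_t)`: bounded `F_t`-measurable scalar random variables. -/
def Linf (F : ℕ → MeasurableSpace Ω) (t : ℕ) : Set (Ω → ℝ) :=
  {x | MeasF (F t) x ∧ ∃ C : ℝ, ∀ ω, |x ω| ≤ C}

/-- The eligible space `M_t = L^∞(F_t) × {0}^{d-1}` (portfolios held in the first asset). -/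
def Mt (F : ℕ → MeasurableSpace Ω) (d t : ℕ) : Set (Ω → Fin d → ℝ) :=
  {m | m ∈ LinfD F d t ∧ ∀ ω, ∀ i : Fin d, (i : ℕ) ≠ 0 → m ω i = 0}

/-- The nonnegative elements `M_{t,+}` of `M_t`. -/
def MtPlus (F : ℕ → MeasurableSpace Ω) (d t : ℕ) : Set (Ω → Fin d → ℝ) :=
  {m | m ∈ Mt F d t ∧ ∀ ω i, 0 ≤ m ω i}

/-- Structural assumptions on the filtration `(F_t)_{t=0}^T`: increasing, contained in the
ambient σ-algebra, `F_T` equal to the ambient σ-algebra, and `F_0` `P`-trivial. -/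
def FiltrationOK [m0 : MeasurableSpace Ω] (F : ℕ → MeasurableSpace Ω) (P : Measure Ω)
    (T : ℕ) : Prop :=
  (∀ s t : ℕ, s ≤ t → F s ≤ F t) ∧ (∀ t, F t ≤ m0) ∧ F T = m0 ∧
    ∀ A : Set Ω, MeasurableSet[F 0] A → P A = 0 ∨ P A = 1

section Meas
variable [MeasurableSpace Ω]

/-- `g` is (a version of) the essential infimum of the set `A` of random variables. -/
def IsEssInfSet (P : Measure Ω) (A : Set (Ω → ℝ)) (g : Ω → ℝ) : Prop :=
  (∀ f ∈ A, ∀ᵐ ω ∂P, g ω ≤ f ω) ∧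
    ∀ h : Ω → ℝ, (∀ f ∈ A, ∀ᵐ ω ∂P, h ω ≤ f ω) → ∀ᵐ ω ∂P, h ω ≤ g ω

/-- `g` is (a version of) the essential supremum of the set `A` of random variables. -/
def IsEssSupSet (P : Measure Ω) (A : Set (Ω → ℝ)) (g : Ω → ℝ) : Prop :=
  (∀ f ∈ A, ∀ᵐ ω ∂P, f ω ≤ g ω) ∧
    ∀ h : Ω → ℝ, (∀ f ∈ A, ∀ᵐ ω ∂P, f ω ≤ h ω) → ∀ᵐ ω ∂P, g ω ≤ h ω

/-- Essential supremum of a set of extended-real-valued random variables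
(to accommodate the values `±∞`). -/
def IsEssSupSetE (P : Measure Ω) (A : Set (Ω → EReal)) (g : Ω → EReal) : Prop :=
  (∀ f ∈ A, ∀ᵐ ω ∂P, f ω ≤ g ω) ∧
    ∀ h : Ω → EReal, (∀ f ∈ A, ∀ᵐ ω ∂P, f ω ≤ h ω) → ∀ᵐ ω ∂P, g ω ≤ h ω

/-- Essential infimum of a set of extended-real-valued random variables. -/
def IsEssInfSetE (P : Measure Ω) (A : Set (Ω → EReal)) (g : Ω → EReal) : Prop :=
  (∀ f ∈ A, ∀ᵐ ω ∂P, g ω ≤ f ω) ∧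
    ∀ h : Ω → EReal, (∀ f ∈ A, ∀ᵐ ω ∂P, h ω ≤ f ω) → ∀ᵐ ω ∂P, h ω ≤ g ω

/-- An (extended-real-valued) random variable lies in `L^∞(F_t)`:
it agrees `P`-a.s. with a bounded `F_t`-measurable real random variable. -/
def MemLinfE (F : ℕ → MeasurableSpace Ω) (P : Measure Ω) (t : ℕ) (g : Ω → EReal) : Prop :=
  ∃ x ∈ Linf F t, g =ᵐ[P] fun ω => (x ω : EReal)

/-- The Radon–Nikodym density `dQ/dP` as a real random variable. -/
def rnd (P Q : Measure Ω) : Ω → ℝ := fun ω => (Q.rnDeriv P ω).toReal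

/-- `ξ̄_{t,T}(Q) = (dQ/dP)/E[dQ/dP | F_t]` on `{E[dQ/dP|F_t] > 0}` and `1` elsewhere. -/
def xiBar (F : ℕ → MeasurableSpace Ω) (P Q : Measure Ω) (t : ℕ) : Ω → ℝ := fun ω =>
  if 0 < (P[rnd P Q | F t]) ω then rnd P Q ω / (P[rnd P Q | F t]) ω else 1

/-- The `P`-a.s. version of the conditional expectation `E^Q[x | F_t]`, defined as
`E[ξ̄_{t,T}(Q) x | F_t]`. -/
def EQcond (F : ℕ → MeasurableSpace Ω) (P Q : Measure Ω) (t : ℕ) (x : Ω → ℝ) : Ω → ℝ :=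
  P[fun ω => xiBar F P Q t ω * x ω | F t]

end Meas

/-- The solvency regions are closed convex cones (pointwise in `ω`). -/
def ConesOK {d : ℕ} (K : ℕ → Ω → Set (Fin d → ℝ)) : Prop :=
  ∀ s (ω : Ω), IsClosed (K s ω) ∧ Convex ℝ (K s ω) ∧
    (0 : Fin d → ℝ) ∈ K s ω ∧ ∀ c : ℝ, 0 ≤ c → ∀ x ∈ K s ω, c • x ∈ K s ω

/-- The trading set `𝕂_t = Σ_{s=t}^T L^∞_d(F_s; K_s)`. -/
def KK (F : ℕ → MeasurableSpace Ω) (d T : ℕ) (K : ℕ → Ω → Set (Fin d → ℝ)) (t : ℕ) :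
    Set (Ω → Fin d → ℝ) :=
  {X | ∃ k : ℕ → Ω → Fin d → ℝ,
      (∀ s, t ≤ s → s ≤ T → k s ∈ LinfD F d s ∧ ∀ ω, k s ω ∈ K s ω) ∧
      ∀ ω, X ω = ∑ s ∈ Finset.Icc t T, k s ω}

/-- Assumption 2.2 of the paper: `K_T ⊇ K̄` a.s. for a convex cone `K̄` with
`int K̄ ⊇ ℝ^d_+ \ {0}`. -/
def FrictionAssumption [MeasurableSpace Ω] (P : Measure Ω) {d : ℕ} (T : ℕ)
    (K : ℕ → Ω → Set (Fin d → ℝ)) : Prop :=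
  ∃ Kbar : Set (Fin d → ℝ), Convex ℝ Kbar ∧
    (∀ c : ℝ, 0 ≤ c → ∀ x ∈ Kbar, c • x ∈ Kbar) ∧
    {x : Fin d → ℝ | (∀ i, 0 ≤ x i) ∧ x ≠ 0} ⊆ interior Kbar ∧
    ∀ᵐ ω ∂P, Kbar ⊆ K T ω

/-- The norm `‖x‖_{𝕂_T,0}` for a deterministic portfolio `x ∈ ℝ^d`:
`inf{c ∈ ℝ : c e₁ − x ∈ 𝕂_T, x + c e₁ ∈ 𝕂_T}`. -/
def normKT0 (F : ℕ → MeasurableSpace Ω) (d T : ℕ) (K : ℕ → Ω → Set (Fin d → ℝ))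
    (x : Fin d → ℝ) : ℝ :=
  sInf {c : ℝ | (fun (_ : Ω) i => c * e1 d i - x i) ∈ KK F d T K T ∧
      (fun (_ : Ω) i => x i + c * e1 d i) ∈ KK F d T K T}

/-- The positive dual cone of a set `C ⊆ ℝ^d`. -/
def dualCone {d : ℕ} (C : Set (Fin d → ℝ)) : Set (Fin d → ℝ) := {y | ∀ x ∈ C, 0 ≤ dot x y}

section MeasP
variable [MeasurableSpace Ω]

/-- The positive dual cone `𝕂_t^+ ⊆ L^1_d` of the trading set `𝕂_t`. -/
def KKplus (F : ℕ → MeasurableSpace Ω) (P : Measure Ω) (d T : ℕ)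
    (K : ℕ → Ω → Set (Fin d → ℝ)) (t : ℕ) : Set (Ω → Fin d → ℝ) :=
  {v | (∀ i : Fin d, Integrable (fun ω => v ω i) P) ∧
      ∀ u ∈ KK F d T K t, 0 ≤ ∫ ω, dot (v ω) (u ω) ∂P}

/-- `(Q,S) ∈ 𝒬_t`: `Q ≪ P` a probability measure and `(S_s)_{s=t}^T` a consistent pricing
process with `S_{s,1} ≡ 1`, the `L^∞` bound `‖S_{s,i}‖_∞ ≤ max{‖e_i‖_{𝕂_T,0},1}`,
`S_s = E^Q[S_T | F_s]` and `(dQ/dP) S_T ∈ 𝕂_t^+`. -/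
def memQt (F : ℕ → MeasurableSpace Ω) (P : Measure Ω) (d T : ℕ)
    (K : ℕ → Ω → Set (Fin d → ℝ)) (t : ℕ) (Q : Measure Ω) (S : ℕ → Ω → Fin d → ℝ) : Prop :=
  IsProbabilityMeasure Q ∧ Q ≪ P ∧
    (∀ s, t ≤ s → s ≤ T →
      S s ∈ LinfD F d s ∧
      (∀ ω, ∀ i : Fin d, (i : ℕ) = 0 → S s ω i = 1) ∧
      (∀ i : Fin d, ∀ ω, |S s ω i| ≤ max (normKT0 F d T K (eVec i)) 1) ∧
      ∀ i : Fin d, (fun ω => S s ω i) =ᵐ[P] EQcond F P Q s fun ω => S T ω i) ∧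
    (fun ω i => rnd P Q ω * S T ω i) ∈ KKplus F P d T K t

/-- `(Q,S) ∈ 𝒬_t^e`: additionally `Q` is equivalent to `P`. -/
def memQtE (F : ℕ → MeasurableSpace Ω) (P : Measure Ω) (d T : ℕ)
    (K : ℕ → Ω → Set (Fin d → ℝ)) (t : ℕ) (Q : Measure Ω) (S : ℕ → Ω → Fin d → ℝ) : Prop :=
  memQt F P d T K t Q S ∧ P ≪ Q

/-- The set `𝒮` of eligible (frictionless) pricing processes. -/
def memS (F : ℕ → MeasurableSpace Ω) (d T : ℕ) (K : ℕ → Ω → Set (Fin d → ℝ))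
    (S : ℕ → Ω → Fin d → ℝ) : Prop :=
  ∀ t ≤ T, S t ∈ LinfD F d t ∧ (∀ ω, S t ω ∈ dualCone (K t ω)) ∧
    (∀ ω, ∀ i : Fin d, (i : ℕ) = 0 → S t ω i = 1) ∧
    ∀ i : Fin d, ∀ ω, |S t ω i| ≤ max (normKT0 F d T K (eVec i)) 1

/-- `Q ∈ 𝒬^e(S)`: `Q` is a probability measure equivalent to `P` under which
`S` is a martingale (with the `P`-a.s. version of conditional expectations). -/
def QeS (F : ℕ → MeasurableSpace Ω) (P : Measure Ω) (d T : ℕ)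
    (S : ℕ → Ω → Fin d → ℝ) : Set (Measure Ω) :=
  {Q | IsProbabilityMeasure Q ∧ Q ≪ P ∧ P ≪ Q ∧
    ∀ s ≤ T, ∀ i : Fin d, (fun ω => S s ω i) =ᵐ[P] EQcond F P Q s fun ω => S T ω i}

/-- The cone `Γ_t(S_t) = {Z ∈ L^∞_d(F_t) : S_t^⊤ Z ≥ 0 a.s.}`. -/
def Gamma (F : ℕ → MeasurableSpace Ω) (P : Measure Ω) (d : ℕ)
    (S : ℕ → Ω → Fin d → ℝ) (t : ℕ) : Set (Ω → Fin d → ℝ) :=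
  {Z | Z ∈ LinfD F d t ∧ ∀ᵐ ω ∂P, 0 ≤ dot (S t ω) (Z ω)}

/-- The set `Σ_{s=0}^T Γ_s(S_s)` of claims attainable from zero. -/
def SumGamma (F : ℕ → MeasurableSpace Ω) (P : Measure Ω) (d T : ℕ)
    (S : ℕ → Ω → Fin d → ℝ) : Set (Ω → Fin d → ℝ) :=
  {X | ∃ Z : ℕ → Ω → Fin d → ℝ, (∀ s ≤ T, Z s ∈ Gamma F P d S s) ∧
      ∀ ω, X ω = ∑ s ∈ Finset.range (T + 1), Z s ω}

/-- The no-arbitrage condition (NA):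
`[Σ_{s=0}^T Γ_s(S_s)] ∩ [−Γ_T(S_T)] ⊆ Γ_T(S_T)`. -/
def NoArb (F : ℕ → MeasurableSpace Ω) (P : Measure Ω) (d T : ℕ)
    (S : ℕ → Ω → Fin d → ℝ) : Prop :=
  ∀ X ∈ SumGamma F P d T S, (fun ω => -X ω) ∈ Gamma F P d S T → X ∈ Gamma F P d S T

/-- `ρ_t` is a scalarized conditional convex risk measure: finite (`L^∞(F_t)`-valued),
conditionally cash invariant in the first asset, monotone, conditionally convex. -/
structure ScalarRM (F : ℕ → MeasurableSpace Ω) (P : Measure Ω) (d T t : ℕ)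
    (rho : (Ω → Fin d → ℝ) → Ω → ℝ) : Prop where
  finite : ∀ X ∈ LinfD F d T, ∃ g ∈ Linf F t, rho X =ᵐ[P] g
  cash : ∀ X ∈ LinfD F d T, ∀ m ∈ Linf F t,
    rho (fun ω => X ω + m ω • e1 d) =ᵐ[P] fun ω => rho X ω - m ω
  mono : ∀ X ∈ LinfD F d T, ∀ Y ∈ LinfD F d T,
    (∀ ω i, X ω i ≤ Y ω i) → rho Y ≤ᵐ[P] rho X
  convex : ∀ X ∈ LinfD F d T, ∀ Y ∈ LinfD F d T, ∀ lam ∈ Linf F t,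
    (∀ ω, lam ω ∈ Set.Icc (0 : ℝ) 1) →
    rho (fun ω => lam ω • X ω + (1 - lam ω) • Y ω) ≤ᵐ[P]
      fun ω => lam ω * rho X ω + (1 - lam ω) * rho Y ω

/-- Conditional positive homogeneity (coherence). -/
def CoherentRM (F : ℕ → MeasurableSpace Ω) (P : Measure Ω) (d T t : ℕ)
    (rho : (Ω → Fin d → ℝ) → Ω → ℝ) : Prop :=
  ∀ X ∈ LinfD F d T, ∀ lam ∈ Linf F t, (∀ ω, 0 ≤ lam ω) →
    rho (fun ω => lam ω • X ω) =ᵐ[P] fun ω => lam ω * rho X ω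

/-- `𝕂_t`-compatibility of a scalar risk measure:
`ρ_t(X) = essinf_{k ∈ 𝕂_t} ρ_t(X−k)`. -/
def KCompat (F : ℕ → MeasurableSpace Ω) (P : Measure Ω) (d T : ℕ)
    (K : ℕ → Ω → Set (Fin d → ℝ)) (t : ℕ) (rho : (Ω → Fin d → ℝ) → Ω → ℝ) : Prop :=
  ∀ X ∈ LinfD F d T,
    IsEssInfSet P {g | ∃ k ∈ KK F d T K t, g = rho fun ω => X ω - k ω} (rho X)

/-- The acceptance set `A_t = {X ∈ L^∞_d(F) : ρ_t(X) ≤ 0}`. -/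
def Acc (F : ℕ → MeasurableSpace Ω) (P : Measure Ω) (d T : ℕ)
    (rho : (Ω → Fin d → ℝ) → Ω → ℝ) : Set (Ω → Fin d → ℝ) :=
  {X | X ∈ LinfD F d T ∧ ∀ᵐ ω ∂P, rho X ω ≤ 0}

/-- `β` is (a version of) the penalty function
`β_t(Q,S) = esssup_{Z ∈ A} −E^Q[S_T^⊤ Z | F_t]`. -/
def IsPenalty (F : ℕ → MeasurableSpace Ω) (P : Measure Ω) (d T t : ℕ)
    (A : Set (Ω → Fin d → ℝ)) (Q : Measure Ω) (S : ℕ → Ω → Fin d → ℝ)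
    (beta : Ω → EReal) : Prop :=
  IsEssSupSetE P
    {g | ∃ Z ∈ A, g = fun ω =>
      ((-(EQcond F P Q t (fun ω' => dot (S T ω') (Z ω')) ω) : ℝ) : EReal)} beta

/-- `g` is (a version of) `π_t^S(X) = esssup_{Q ∈ 𝒬^e(S)} (−β_t(Q,S) − E^Q[S_T^⊤ X|F_t])`. -/
def IsPi (F : ℕ → MeasurableSpace Ω) (P : Measure Ω) (d T t : ℕ)
    (beta : Measure Ω → Ω → EReal) (S : ℕ → Ω → Fin d → ℝ) (X : Ω → Fin d → ℝ)
    (g : Ω → EReal) : Prop :=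
  IsEssSupSetE P
    {h | ∃ Q ∈ QeS F P d T S, h = fun ω =>
      -beta Q ω - ((EQcond F P Q t (fun ω' => dot (S T ω') (X ω')) ω : ℝ) : EReal)} g

/-- The Fatou property of `ρ_t`. -/
def Fatou (F : ℕ → MeasurableSpace Ω) (P : Measure Ω) (d T : ℕ)
    (rho : (Ω → Fin d → ℝ) → Ω → ℝ) : Prop :=
  ∀ X ∈ LinfD F d T, ∀ Xn : ℕ → Ω → Fin d → ℝ, (∀ n, Xn n ∈ LinfD F d T) →
    (∃ C : ℝ, ∀ n ω i, |Xn n ω i| ≤ C) →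
    (∀ᵐ ω ∂P, Tendsto (fun n => Xn n ω) atTop (nhds (X ω))) →
    ∀ᵐ ω ∂P, rho X ω ≤ atTop.liminf fun n => rho (Xn n) ω

/-- Relevance (sensitivity): `P(ρ_t(−ε 1_D e₁) > ρ_t(0)) > 0` for all `ε > 0` and all
`D ∈ F` with positive probability. -/
def Relevant (P : Measure Ω) (d : ℕ) (rho : (Ω → Fin d → ℝ) → Ω → ℝ) : Prop :=
  ∀ ε : ℝ, 0 < ε → ∀ D : Set Ω, MeasurableSet D → 0 < P D →
    0 < P {ω | rho (fun _ _ => 0) ω <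
      rho (fun ω' => (-(ε * D.indicator (fun _ => (1 : ℝ)) ω')) • e1 d) ω}

end MeasP

section Auxiliary

/-- Every family of measurable sets has a countable subfamily whose union contains each member
up to a null set. -/
lemma exists_countable_essUnion {ι : Type*} [MeasurableSpace Ω] (P : Measure Ω)
    [IsFiniteMeasure P] (s : ι → Set Ω) (hs : ∀ i, MeasurableSet (s i)) :
    ∃ B : Set ι, B.Countable ∧ ∀ i, P (s i \ ⋃ j ∈ B, s j) = 0 := by
  let R : Set ℝ≥0∞ := (fun B : Set ι => P (⋃ j ∈ B, s j)) '' {B | B.Countable}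
  have hR : R.Nonempty := ⟨_, ∅, countable_empty, rfl⟩
  obtain ⟨u, -, hu, huR⟩ := exists_seq_tendsto_sSup hR (OrderTop.bddAbove R)
  choose B hBc hBu using huR
  have hc : (⋃ n, B n).Countable := countable_iUnion hBc
  refine ⟨⋃ n, B n, hc, fun i => ?_⟩
  set U : Set Ω := ⋃ j ∈ ⋃ n, B n, s j with hU
  have hUmeas : MeasurableSet U := MeasurableSet.biUnion hc fun j _ => hs j
  have hle : sSup R ≤ P U := by
    refine le_of_tendsto' hu fun n => ?_
    rw [← hBu n]
    exact measure_mono (biUnion_subset_biUnion_left (subset_iUnion B n))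
  have hins : P (U ∪ s i \ U) ≤ sSup R := by
    refine le_sSup ⟨insert i (⋃ n, B n), hc.insert i, ?_⟩
    simp only [biUnion_insert]
    rw [← hU, union_sdiff_self, union_comm]
  rw [measure_union disjoint_sdiff_right ((hs i).diff hUmeas)] at hins
  have h0 : P U + P (s i \ U) ≤ P U + 0 := by simpa using hins.trans hle
  exact le_antisymm ((ENNReal.add_le_add_iff_left (measure_ne_top P U)).1 h0) zero_le

/-- A family of extended-real-valued measurable functions has a countable subfamily whose
pointwise supremum dominates each member almost everywhere. -/
lemma exists_countable_essSup {ι : Type*} [MeasurableSpace Ω] (P : Measure Ω)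
    [IsFiniteMeasure P] (f : ι → Ω → EReal) (hf : ∀ i, Measurable (f i)) :
    ∃ B : Set ι, B.Countable ∧ ∀ i, ∀ᵐ ω ∂P, f i ω ≤ ⨆ j ∈ B, f j ω := by
  choose B hBc hB using fun q : ℚ => exists_countable_essUnion P
    (fun i => {ω | ((q : ℝ) : EReal) < f i ω}) fun i => measurableSet_lt measurable_const (hf i)
  refine ⟨⋃ q, B q, countable_iUnion hBc, fun i => ?_⟩
  have h : ∀ᵐ ω ∂P, ∀ q : ℚ,
      ω ∉ {ω | ((q : ℝ) : EReal) < f i ω} \ ⋃ j ∈ B q, {ω | ((q : ℝ) : EReal) < f j ω} :=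
    ae_all_iff.2 fun q => measure_eq_zero_iff_ae_notMem.1 (hB q i)
  filter_upwards [h] with ω hω
  by_contra! hlt
  obtain ⟨q, hq1, hq2⟩ := EReal.lt_iff_exists_rat_btwn.1 hlt
  have hmem : ω ∈ ⋃ j ∈ B q, {ω | ((q : ℝ) : EReal) < f j ω} := by
    by_contra hcon
    exact hω q ⟨hq2, hcon⟩
  simp only [mem_iUnion, mem_ofPred_eq] at hmem
  obtain ⟨j, hj, hqj⟩ := hmem
  have hle : f j ω ≤ ⨆ j ∈ ⋃ q, B q, f j ω :=
    le_iSup₂ (f := fun j (_ : j ∈ ⋃ q, B q) => f j ω) j (mem_iUnion.2 ⟨q, hj⟩)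
  exact absurd (hqj.trans_le hle) hq1.not_gt

/-- The essential supremum of a set of functions, each a.e. equal to an `m`-measurable one, is
a.e. equal to an `m`-measurable function. -/
lemma IsEssSupSetE.exists_measurable {m : MeasurableSpace Ω} [m0 : MeasurableSpace Ω]
    {P : Measure Ω} [IsFiniteMeasure P] (hm : m ≤ m0) {A : Set (Ω → EReal)}
    {g : Ω → EReal} (hg : IsEssSupSetE P A g)
    (hA : ∀ f ∈ A, ∃ f', Measurable[m] f' ∧ f =ᵐ[P] f') :
    ∃ g', Measurable[m] g' ∧ g =ᵐ[P] g' := by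
  choose v hv hvf using fun f : A => hA f f.2
  obtain ⟨B, hBc, hB⟩ := exists_countable_essSup P v fun f => (hv f).mono hm le_rfl
  refine ⟨fun ω => ⨆ j ∈ B, v j ω, Measurable.biSup B hBc fun j _ => hv j, ?_⟩
  have h1 : ∀ᵐ ω ∂P, g ω ≤ ⨆ j ∈ B, v j ω := by
    refine hg.2 _ fun f hf => ?_
    filter_upwards [hvf ⟨f, hf⟩, hB ⟨f, hf⟩] with ω h h'
    exact h.trans_le h'
  have h2 : ∀ᵐ ω ∂P, ∀ j ∈ B, v j ω ≤ g ω := by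
    refine (ae_ball_iff hBc).2 fun j _ => ?_
    filter_upwards [hvf j, hg.1 j j.2] with ω h h'
    exact h ▸ h'
  filter_upwards [h1, h2] with ω h h'
  exact le_antisymm h (iSup₂_le h')

/-- The reciprocal of the conditional density, set to `0` where the latter is not positive. -/
def condDensityInv [MeasurableSpace Ω] (F : ℕ → MeasurableSpace Ω) (P Q : Measure Ω) (t : ℕ) :
    Ω → ℝ := fun ω =>
  if 0 < (P[rnd P Q | F t]) ω then ((P[rnd P Q | F t]) ω)⁻¹ else 0

/-- The indicator of the event on which the conditional density is not positive. -/
def condDensityNonpos [MeasurableSpace Ω] (F : ℕ → MeasurableSpace Ω) (P Q : Measure Ω) (t : ℕ) :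
    Ω → ℝ := fun ω =>
  if 0 < (P[rnd P Q | F t]) ω then 0 else 1

lemma xiBar_eq [MeasurableSpace Ω] (F : ℕ → MeasurableSpace Ω) (P Q : Measure Ω) (t : ℕ) :
    xiBar F P Q t = condDensityInv F P Q t * rnd P Q + condDensityNonpos F P Q t := by
  funext ω
  simp only [xiBar, condDensityInv, condDensityNonpos, Pi.add_apply, Pi.mul_apply]
  split_ifs
  · rw [add_zero, div_eq_inv_mul]
  · rw [zero_mul, zero_add]

lemma condDensityInv_nonneg [MeasurableSpace Ω] (F : ℕ → MeasurableSpace Ω) (P Q : Measure Ω)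
    (t : ℕ) (ω : Ω) : 0 ≤ condDensityInv F P Q t ω := by
  unfold condDensityInv
  split_ifs with h
  · exact (inv_pos.2 h).le
  · exact le_rfl

lemma xiBar_nonneg [MeasurableSpace Ω] (F : ℕ → MeasurableSpace Ω) (P Q : Measure Ω) (t : ℕ)
    (ω : Ω) : 0 ≤ xiBar F P Q t ω := by
  unfold xiBar
  split_ifs with h
  · exact div_nonneg ENNReal.toReal_nonneg h.le
  · exact zero_le_one

lemma dot_smul_e1 {d : ℕ} (hd : 0 < d) {s : Fin d → ℝ} (hs : ∀ i : Fin d, (i : ℕ) = 0 → s i = 1)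
    (z : ℝ) : dot s (z • e1 d) = z := by
  unfold dot e1
  rw [Finset.sum_eq_single (⟨0, hd⟩ : Fin d)]
  · simp [hs ⟨0, hd⟩ rfl]
  · intro i _ hi
    have hi' : (i : ℕ) ≠ 0 := fun h => hi (Fin.ext h)
    simp [hi']
  · simp

lemma smul_e1_mem_LinfD {F : ℕ → MeasurableSpace Ω} {d T : ℕ} {Z : Ω → ℝ} (hZ : Z ∈ Linf F T) :
    (fun ω => Z ω • e1 d) ∈ LinfD F d T := by
  obtain ⟨hZm, C, hC⟩ := hZ
  have hZm' : Measurable[F T] Z := hZm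
  refine ⟨@measurable_pi_lambda _ _ _ (F T) _ _ fun i => hZm'.mul_const _, C, fun ω i => ?_⟩
  have h0 := (abs_nonneg _).trans (hC ω)
  by_cases hi : (i : ℕ) = 0
  · simpa [e1, hi] using hC ω
  · simpa [e1, hi] using h0

lemma add_mem_Linf {F : ℕ → MeasurableSpace Ω} {s : ℕ} {x y : Ω → ℝ} (hx : x ∈ Linf F s) (hy : y ∈ Linf F s) :
    (fun ω => x ω + y ω) ∈ Linf F s := by
  obtain ⟨hxm, C, hC⟩ := hx
  obtain ⟨hym, D, hD⟩ := hy
  have hxm' : Measurable[F s] x := hxm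
  have hym' : Measurable[F s] y := hym
  exact ⟨hxm'.add hym', C + D, fun ω => (abs_add_le _ _).trans (add_le_add (hC ω) (hD ω))⟩

lemma neg_sub_coe_add_le_iff (b : EReal) (a x y : ℝ) :
    -b - ((a + x : ℝ) : EReal) ≤ (y : EReal) ↔ -b - (a : EReal) ≤ ((y + x : ℝ) : EReal) := by
  induction b with
  | bot => simp [-EReal.coe_add]
  | top => simp [-EReal.coe_add]
  | coe b =>
    norm_cast
    constructor <;> intro h <;> linarith

variable [m0 : MeasurableSpace Ω] {F : ℕ → MeasurableSpace Ω} {P Q : Measure Ω} {t : ℕ}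

lemma measurable_condDensityInv : Measurable[F t] (condDensityInv F P Q t) :=
  Measurable.ite
    (measurableSet_lt measurable_const stronglyMeasurable_condExp.measurable)
    stronglyMeasurable_condExp.measurable.inv measurable_const

lemma measurable_condDensityNonpos : Measurable[F t] (condDensityNonpos F P Q t) :=
  Measurable.ite
    (measurableSet_lt measurable_const stronglyMeasurable_condExp.measurable)
    measurable_const measurable_const

lemma integrable_condDensityNonpos [IsProbabilityMeasure P] (hm : F t ≤ m0) :
    Integrable (condDensityNonpos F P Q t) P := by
  refine Integrable.of_bound
    (measurable_condDensityNonpos.mono hm le_rfl).aestronglyMeasurable 1 (ae_of_all _ fun ω => ?_)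
  unfold condDensityNonpos
  split_ifs <;> simp

lemma integrable_condDensityInv_mul_rnd [IsProbabilityMeasure P] [IsProbabilityMeasure Q]
    (hQP : Q ≪ P) (hm : F t ≤ m0) : Integrable (condDensityInv F P Q t * rnd P Q) P := by
  have hinv : Measurable[F t] fun ω => ENNReal.ofReal (condDensityInv F P Q t ω) :=
    measurable_condDensityInv.ennreal_ofReal
  have hrnd : Measurable (rnd P Q) := (Measure.measurable_rnDeriv Q P).ennreal_toReal
  refine ⟨((measurable_condDensityInv.mono hm le_rfl).mul hrnd).aestronglyMeasurable, ?_⟩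
  have hnonneg : 0 ≤ᵐ[P] condDensityInv F P Q t * rnd P Q :=
    ae_of_all _ fun ω => mul_nonneg (condDensityInv_nonneg F P Q t ω) ENNReal.toReal_nonneg
  rw [hasFiniteIntegral_iff_ofReal hnonneg]
  have h1 : ∫⁻ ω, ENNReal.ofReal ((condDensityInv F P Q t * rnd P Q) ω) ∂P
      = ∫⁻ ω, Q.rnDeriv P ω * ENNReal.ofReal (condDensityInv F P Q t ω) ∂P := by
    refine lintegral_congr_ae ?_
    filter_upwards [Q.rnDeriv_ne_top P] with ω hω
    rw [Pi.mul_apply, ENNReal.ofReal_mul (condDensityInv_nonneg F P Q t ω), mul_comm, rnd,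
      ENNReal.ofReal_toReal hω]
  have h2 : ∫⁻ ω, (Q.trim hm).rnDeriv (P.trim hm) ω *
        ENNReal.ofReal (condDensityInv F P Q t ω) ∂(P.trim hm)
      ≤ ∫⁻ _, 1 ∂(P.trim hm) := by
    refine lintegral_mono_ae ?_
    filter_upwards [rnDeriv_trim hm hQP] with ω hω
    rw [hω, ← ENNReal.ofReal_mul' (condDensityInv_nonneg F P Q t ω)]
    refine ENNReal.ofReal_le_one.2 ?_
    change (P[rnd P Q | F t]) ω * condDensityInv F P Q t ω ≤ 1
    unfold condDensityInv
    split_ifs with h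
    · exact (mul_inv_cancel₀ h.ne').le
    · simp
  rw [h1, lintegral_rnDeriv_mul hQP (hinv.mono hm le_rfl).aemeasurable, ← lintegral_trim hm hinv,
    ← lintegral_rnDeriv_mul (hQP.trim hm) hinv.aemeasurable]
  refine h2.trans_lt ?_
  simp [trim_measurableSet_eq hm MeasurableSet.univ]

lemma integrable_xiBar [IsProbabilityMeasure P] [IsProbabilityMeasure Q]
    (hQP : Q ≪ P) (hm : F t ≤ m0) : Integrable (xiBar F P Q t) P := by
  rw [xiBar_eq]
  exact (integrable_condDensityInv_mul_rnd hQP hm).add (integrable_condDensityNonpos hm)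

lemma condExp_xiBar [IsProbabilityMeasure P] [IsProbabilityMeasure Q]
    (hQP : Q ≪ P) (hm : F t ≤ m0) : P[xiBar F P Q t | F t] =ᵐ[P] fun _ => 1 := by
  rw [xiBar_eq]
  have hi := integrable_condDensityInv_mul_rnd hQP hm
  have hN := integrable_condDensityNonpos (P := P) (Q := Q) hm
  filter_upwards [condExp_add hi hN (F t),
    condExp_mul_of_stronglyMeasurable_left (m := F t) (g := rnd P Q)
      measurable_condDensityInv.stronglyMeasurable hi Measure.integrable_toReal_rnDeriv] with ω h1 h2
  rw [h1, Pi.add_apply, h2, condExp_of_stronglyMeasurable hm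
    measurable_condDensityNonpos.stronglyMeasurable hN]
  change condDensityInv F P Q t ω * (P[rnd P Q | F t]) ω + condDensityNonpos F P Q t ω = 1
  unfold condDensityInv condDensityNonpos
  split_ifs with h
  · rw [inv_mul_cancel₀ h.ne', add_zero]
  · rw [zero_mul, zero_add]

lemma integrable_xiBar_mul [IsProbabilityMeasure P] [IsProbabilityMeasure Q]
    (hQP : Q ≪ P) (hm : F t ≤ m0) {x : Ω → ℝ} (hx : Measurable x) {C : ℝ}
    (hC : ∀ ω, |x ω| ≤ C) : Integrable (fun ω => xiBar F P Q t ω * x ω) P :=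
  (integrable_xiBar hQP hm).mul_bdd (c := C) hx.aestronglyMeasurable (ae_of_all _ hC)

lemma EQcond_of_measurable [IsProbabilityMeasure P] [IsProbabilityMeasure Q]
    (hQP : Q ≪ P) (hm : F t ≤ m0) {x : Ω → ℝ} (hx : x ∈ Linf F t) :
    EQcond F P Q t x =ᵐ[P] x := by
  obtain ⟨hxm, C, hC⟩ := hx
  have hxm' : Measurable[F t] x := hxm
  filter_upwards [condExp_xiBar hQP hm, condExp_mul_of_stronglyMeasurable_right
    hxm'.stronglyMeasurable
    (integrable_xiBar_mul hQP hm (hxm'.mono hm le_rfl) hC) (integrable_xiBar hQP hm)] with ω h1 h2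
  refine h2.trans ?_
  rw [Pi.mul_apply, h1, one_mul]

lemma EQcond_add [IsProbabilityMeasure P] [IsProbabilityMeasure Q]
    (hQP : Q ≪ P) (hm : F t ≤ m0) {z x : Ω → ℝ} (hz : Measurable z) {C : ℝ}
    (hC : ∀ ω, |z ω| ≤ C) (hx : x ∈ Linf F t) :
    EQcond F P Q t (fun ω => z ω + x ω) =ᵐ[P] fun ω => EQcond F P Q t z ω + x ω := by
  have hx' := hx
  obtain ⟨hxm, D, hD⟩ := hx'
  have hxm' : Measurable[F t] x := hxm
  have h := condExp_add (integrable_xiBar_mul hQP hm hz hC)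
    (integrable_xiBar_mul hQP hm (hxm'.mono hm le_rfl) hD) (F t)
  filter_upwards [h, EQcond_of_measurable hQP hm hx] with ω h1 h2
  rw [EQcond] at h2
  rw [Pi.add_apply, h2] at h1
  rw [EQcond, EQcond, ← h1]
  congr 2
  funext ω
  simp only [Pi.add_apply, mul_add]

lemma abs_EQcond_le [IsProbabilityMeasure P] [IsProbabilityMeasure Q]
    (hQP : Q ≪ P) (hm : F t ≤ m0) {z : Ω → ℝ} (hz : Measurable z) {C : ℝ}
    (hC : ∀ ω, |z ω| ≤ C) : ∀ᵐ ω ∂P, |EQcond F P Q t z ω| ≤ C := by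
  have hconst : ∀ c : ℝ, (fun _ : Ω => c) ∈ Linf F t := fun c =>
    ⟨measurable_const, |c|, fun _ => le_rfl⟩
  have hi : ∀ c : ℝ, Integrable (fun ω => xiBar F P Q t ω * c) P := fun c =>
    (integrable_xiBar hQP hm).mul_const c
  have hiz := integrable_xiBar_mul (t := t) hQP hm hz hC
  filter_upwards [EQcond_of_measurable hQP hm (hconst C), EQcond_of_measurable hQP hm (hconst (-C)),
    condExp_mono (m := F t) hiz (hi C) (ae_of_all _ fun ω =>
      mul_le_mul_of_nonneg_left (abs_le.1 (hC ω)).2 (xiBar_nonneg F P Q t ω)),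
    condExp_mono (m := F t) (hi (-C)) hiz (ae_of_all _ fun ω =>
      mul_le_mul_of_nonneg_left (abs_le.1 (hC ω)).1 (xiBar_nonneg F P Q t ω))] with ω h1 h2 h3 h4
  exact abs_le.2 ⟨h2.ge.trans h4, h3.trans h1.le⟩

lemma measurable_EQcond (x : Ω → ℝ) : Measurable[F t] (EQcond F P Q t x) :=
  stronglyMeasurable_condExp.measurable

lemma Relevant.dim_pos [IsProbabilityMeasure P] {d : ℕ} {rho : (Ω → Fin d → ℝ) → Ω → ℝ}
    (h : Relevant P d rho) : 0 < d := by
  rcases Nat.eq_zero_or_pos d with rfl | hd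
  · have h1 := h 1 one_pos univ MeasurableSet.univ (by simp)
    rw [Subsingleton.elim (fun ω : Ω =>
      (-(1 * (univ : Set Ω).indicator (fun _ => (1 : ℝ)) ω)) • e1 0) fun _ _ => 0] at h1
    simp at h1
  · exact hd

/-- The scalarised dual risk measure is essentially bounded and measurable at time `t`. -/
lemma memLinfE_essSup [IsProbabilityMeasure P] {T d : ℕ} (hm : F t ≤ m0)
    {S : ℕ → Ω → Fin d → ℝ} {beta : Measure Ω → Ω → EReal}
    (hbeta : ∀ Q ∈ QeS F P d T S, ∃ b, Measurable[F t] b ∧ beta Q =ᵐ[P] b)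
    {g0 g : Ω → EReal} (h0 : MemLinfE F P t g0)
    (hg0 : IsEssSupSetE P {g | ∃ Q ∈ QeS F P d T S, g = fun ω => -beta Q ω -
      ((EQcond F P Q t (fun _ => 0) ω : ℝ) : EReal)} g0)
    {Z : Ω → ℝ} (hZ : Measurable Z) {C : ℝ} (hC : ∀ ω, |Z ω| ≤ C)
    (hg : IsEssSupSetE P {g | ∃ Q ∈ QeS F P d T S, g = fun ω => -beta Q ω -
      ((EQcond F P Q t Z ω : ℝ) : EReal)} g) :
    MemLinfE F P t g := by
  obtain ⟨g', hg'm, hg'⟩ := hg.exists_measurable hm <| by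
    rintro _ ⟨Q, hQ, rfl⟩
    obtain ⟨b, hb, hbb⟩ := hbeta Q hQ
    refine ⟨fun ω => -b ω + ((-EQcond F P Q t Z ω : ℝ) : EReal),
      hb.neg.add (measurable_coe_real_ereal.comp (measurable_EQcond Z).neg), ?_⟩
    filter_upwards [hbb] with ω hω
    rw [hω, sub_eq_add_neg, EReal.coe_neg]
  obtain ⟨x, ⟨-, D, hD⟩, hx⟩ := h0
  have hzero : ∀ Q ∈ QeS F P d T S, ∀ᵐ ω ∂P, EQcond F P Q t (fun _ => 0) ω = 0 := by
    rintro Q ⟨hQ, hQP, -⟩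
    filter_upwards [abs_EQcond_le (t := t) hQP hm (measurable_const (a := (0 : ℝ))) (C := 0)
      (by simp)] with ω hω
    exact abs_nonpos_iff.1 hω
  have hupper : ∀ᵐ ω ∂P, g ω ≤ ((D + C : ℝ) : EReal) := by
    refine hg.2 _ ?_
    rintro _ ⟨Q, hQ, rfl⟩
    have hQ' := hQ
    obtain ⟨hQprob, hQP, -⟩ := hQ'
    filter_upwards [hg0.1 _ ⟨Q, hQ, rfl⟩, hzero Q hQ, abs_EQcond_le (t := t) hQP hm hZ hC, hx]
      with ω h1 h2 h3 h4
    rw [h2, h4] at h1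
    have h5 : -beta Q ω - ((0 : ℝ) : EReal) ≤
        ((D + C + EQcond F P Q t Z ω : ℝ) : EReal) := h1.trans <| EReal.coe_le_coe_iff.2 <| by
      linarith [(abs_le.1 (hD ω)).2, (abs_le.1 h3).1]
    simpa only [zero_add] using (neg_sub_coe_add_le_iff _ 0 _ _).2 h5
  have hlower : ∀ᵐ ω ∂P, ((-(D + C) : ℝ) : EReal) ≤ g ω := by
    have hg0g : ∀ᵐ ω ∂P, g0 ω ≤ g ω + (C : EReal) := by
      refine hg0.2 _ ?_
      rintro _ ⟨Q, hQ, rfl⟩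
      have hQ' := hQ
      obtain ⟨hQprob, hQP, -⟩ := hQ'
      filter_upwards [hg.1 _ ⟨Q, hQ, rfl⟩, hzero Q hQ, abs_EQcond_le (t := t) hQP hm hZ hC, hupper]
        with ω h1 h2 h3 h4
      rw [h2]
      have h5 := add_le_add_left h1 (C : EReal)
      refine le_trans ?_ h5
      rw [sub_eq_add_neg, sub_eq_add_neg, add_assoc, ← EReal.coe_neg, ← EReal.coe_neg,
        ← EReal.coe_add]
      refine add_le_add_right (EReal.coe_le_coe_iff.2 ?_) _
      linarith [(abs_le.1 h3).2]
    filter_upwards [hg0g, hx] with ω h1 h2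
    rw [h2] at h1
    have h3 : ((-D : ℝ) : EReal) ≤ g ω + (C : EReal) :=
      (EReal.coe_le_coe_iff.2 (abs_le.1 (hD ω)).1).trans h1
    have h4 := EReal.sub_le_of_le_add h3
    rw [← EReal.coe_sub] at h4
    rwa [neg_add, ← sub_eq_add_neg]
  refine ⟨fun ω => max (-(D + C)) (min (D + C) (g' ω).toReal),
    ⟨Measurable.max measurable_const (Measurable.min measurable_const hg'm.ereal_toReal),
      |D + C|, fun ω => ?_⟩, ?_⟩
  · refine abs_le.2 ⟨(neg_le_neg (le_abs_self _)).trans (le_max_left _ _),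
      max_le (neg_le_abs _) ((min_le_left _ _).trans (le_abs_self _))⟩
  · filter_upwards [hg', hupper, hlower] with ω h1 h2 h3
    rw [← h1]
    have htop : g ω ≠ ⊤ := (h2.trans_lt (EReal.coe_lt_top _)).ne
    have hbot : g ω ≠ ⊥ := ((EReal.bot_lt_coe _).trans_le h3).ne'
    lift g ω to ℝ using ⟨htop, hbot⟩ with y
    rw [EReal.toReal_coe, min_eq_right (EReal.coe_le_coe_iff.1 h2),
      max_eq_right (EReal.coe_le_coe_iff.1 h3)]

end Auxiliary

/-- Corollary 5.12.  For `S ∈ 𝒮_t`, the univariate risk measure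
`φ_t^S(Z) = π_t^S(Z e₁)` has the primal representation
`φ_t^S(Z) = essinf{m ∈ L^∞(F_t) : Z + m ∈ S_T^⊤ A_t^π}` and the dual representation
`φ_t^S(Z) = esssup_{Q ∈ 𝒬^e(S)} (−β_t(Q,S) − E^Q[Z | F_t])` for every `Z ∈ L^∞(F)`. -/
theorem statement12 [MeasurableSpace Ω] (F : ℕ → MeasurableSpace Ω) (P : Measure Ω)
    [IsProbabilityMeasure P] (d T t : ℕ) (ht : t ≤ T) (K : ℕ → Ω → Set (Fin d → ℝ))
    (hFil : FiltrationOK F P T) (hK : ConesOK K) (hKbar : FrictionAssumption P T K)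
    (rho : (Ω → Fin d → ℝ) → Ω → ℝ)
    (hrho : ScalarRM F P d T t rho) (hKcomp : KCompat F P d T K t rho)
    (hFatou : Fatou F P d T rho) (hRel : Relevant P d rho)
    (beta : Measure Ω → Ω → EReal)
    (S : ℕ → Ω → Fin d → ℝ) (hS : memS F d T K S)
    (hbeta : ∀ Q ∈ QeS F P d T S, IsPenalty F P d T t (Acc F P d T rho) Q S (beta Q))
    (pi : (Ω → Fin d → ℝ) → Ω → EReal)
    (hpi : ∀ X ∈ LinfD F d T, IsPi F P d T t beta S X (pi X))
    -- `S ∈ 𝒮_t`, i.e. `π_t^S(0) ∈ L^∞(F_t)`: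
    (hSt : MemLinfE F P t (pi fun _ _ => 0)) :
    ∀ Z ∈ Linf F T,
      -- primal representation, with `A_t^π = {X ∈ L^∞_d(F) : π_t^S(X) ≤ 0}`:
      IsEssInfSetE P
        {g | ∃ m ∈ Linf F t,
          (∃ X, (X ∈ LinfD F d T ∧ ∀ᵐ ω ∂P, pi X ω ≤ 0) ∧
            (fun ω => Z ω + m ω) =ᵐ[P] fun ω => dot (S T ω) (X ω)) ∧
          g = fun ω => ((m ω : ℝ) : EReal)}
        (pi fun ω => Z ω • e1 d) ∧
      -- dual representation:
      IsEssSupSetE P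
        {g | ∃ Q ∈ QeS F P d T S, g = fun ω =>
          -beta Q ω - ((EQcond F P Q t Z ω : ℝ) : EReal)}
        (pi fun ω => Z ω • e1 d) := by
  intro Z hZ
  obtain ⟨hmono, hle, hFT, -⟩ := hFil
  have hm := hle t
  have hd : 0 < d := hRel.dim_pos
  have hS1 : ∀ ω, ∀ i : Fin d, (i : ℕ) = 0 → S T ω i = 1 := (hS T le_rfl).2.2.1
  have hdual : ∀ Y ∈ Linf F T, IsEssSupSetE P
      {g | ∃ Q ∈ QeS F P d T S, g = fun ω => -beta Q ω - ((EQcond F P Q t Y ω : ℝ) : EReal)}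
      (pi fun ω => Y ω • e1 d) := by
    intro Y hY
    have h := hpi _ (smul_e1_mem_LinfD hY)
    simpa only [IsPi, dot_smul_e1 hd (hS1 _)] using h
  refine ⟨?_, hdual Z hZ⟩
  obtain ⟨hZm, C, hC⟩ := id hZ
  have hZm' : Measurable Z := Measurable.mono hZm (hle T) le_rfl
  have hzero : (fun _ : Ω => (0 : ℝ)) ∈ Linf F T := ⟨measurable_const, 0, by simp⟩
  have hpi0 := hdual _ hzero
  have hlift0 : (fun _ : Ω => (0 : ℝ) • e1 d) = fun _ _ => 0 := by
    funext ω i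
    simp
  rw [hlift0] at hpi0
  have hbetam : ∀ Q ∈ QeS F P d T S, ∃ b, Measurable[F t] b ∧ beta Q =ᵐ[P] b := by
    intro Q hQ
    refine (hbeta Q hQ).exists_measurable hm ?_
    rintro _ ⟨X, -, rfl⟩
    exact ⟨_, measurable_coe_real_ereal.comp (measurable_EQcond _).neg, ae_eq_refl _⟩
  constructor
  · rintro _ ⟨m, hmt, ⟨X, ⟨hX, hXpi⟩, hZX⟩, rfl⟩
    refine (hdual Z hZ).2 _ ?_
    rintro _ ⟨Q, hQ, rfl⟩
    have hQ' := hQ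
    obtain ⟨hQprob, hQP, -⟩ := hQ'
    have hcongr : EQcond F P Q t (fun ω => Z ω + m ω) =ᵐ[P]
        EQcond F P Q t (fun ω => dot (S T ω) (X ω)) := by
      refine condExp_congr_ae ?_
      filter_upwards [hZX] with ω hω
      rw [hω]
    filter_upwards [(hpi X hX).1 _ ⟨Q, hQ, rfl⟩, hXpi, hcongr, EQcond_add hQP hm hZm' hC hmt]
      with ω h1 h2 h3 h4
    rw [← h3, h4] at h1
    simpa only [zero_add] using (neg_sub_coe_add_le_iff _ _ _ 0).1 (h1.trans h2)
  · intro h hh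
    obtain ⟨m, hmt, hm_eq⟩ := memLinfE_essSup hm hbetam hSt hpi0 hZm' hC (hdual Z hZ)
    have hmT : m ∈ Linf F T := ⟨Measurable.mono hmt.1 (hmono t T ht) le_rfl, hmt.2⟩
    have hZmT := add_mem_Linf hZ hmT
    have hacc : ∀ᵐ ω ∂P, pi (fun ω => (Z ω + m ω) • e1 d) ω ≤ 0 := by
      refine (hdual _ hZmT).2 (fun _ => 0) ?_
      rintro _ ⟨Q, hQ, rfl⟩
      have hQ' := hQ
      obtain ⟨hQprob, hQP, -⟩ := hQ'
      filter_upwards [(hdual Z hZ).1 _ ⟨Q, hQ, rfl⟩, hm_eq, EQcond_add hQP hm hZm' hC hmt]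
        with ω h1 h2 h3
      rw [h2] at h1
      rw [h3]
      refine (neg_sub_coe_add_le_iff _ _ _ 0).2 ?_
      simpa only [zero_add] using h1
    have hle_m := hh _ ⟨m, hmt, ⟨_, ⟨smul_e1_mem_LinfD hZmT, hacc⟩,
      ae_of_all _ fun ω => (dot_smul_e1 hd (hS1 ω) _).symm⟩, rfl⟩
    filter_upwards [hle_m, hm_eq] with ω h1 h2
    exact h2 ▸ h1

end RiskPaper
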